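/- For every ω ∉ B (so that H(1ω) < ∞) and every ε > 0, ν([ω_{[1,2n]}] ∩ A^ω_{ε,2n}) / ν([ω_{[1,2n]}]) → 0 as n → ∞. (Here ν([ω_{[1,2n]}]) = 2^{−2n}, so equivalently 2^{2n} · ν([ω_{[1,2n]}] ∩ A^ω_{ε,2n}) → 0.) -/

import Mathlib

open MeasureTheory Filter Topology
open scoped ENNReal

namespace WeakGibbsExample

/-- Configuration space `Ω = {0,1}^{ℤ≥0}`. -/
abbrev Conf := ℕ → Bool

/-- `ν` is the Bernoulli(1/2,1/2) product measure on `{0,1}^{ℤ≥0}`: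
a probability measure giving each cylinder on a finite set `s` measure `2^{-|s|}`. -/
def IsBernoulliHalf (ν : Measure Conf) : Prop :=
  IsProbabilityMeasure ν ∧
    ∀ (s : Finset ℕ) (f : ℕ → Bool),
      ν {ζ | ∀ i ∈ s, ζ i = f i} = (2 : ℝ≥0∞)⁻¹ ^ s.card

/-- `N_m(ω)`: the length of the maximal run of `1`s in `ω` ending at site `m`
(`0` if `ω m = 0`). -/
def runLen (ω : Conf) (m : ℕ) : ℕ :=
  Nat.findGreatest (fun j => 0 < j ∧ ∀ i < j, ω (m - i) = true) (m + 1)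

/-- The potential term `U([0,2p], ω) = ω_0 ω_{2p} ρ^{p - N_{2p}(ω)} 𝟙{N_{2p}(ω) ≤ p}`. -/
noncomputable def U (ρ : ℝ) (ω : Conf) (p : ℕ) : ℝ :=
  if ω 0 = true ∧ ω (2 * p) = true ∧ runLen ω (2 * p) ≤ p then
    ρ ^ (p - runLen ω (2 * p))
  else 0

/-- The Hamiltonian `H(ω) = Σ_{n ≥ 1} U([0,2n], ω) ∈ [0,∞]`. -/
noncomputable def H (ρ : ℝ) (ω : Conf) : ℝ≥0∞ :=
  ∑' n : ℕ, ENNReal.ofReal (U ρ ω (n + 1))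

/-- `B_k = {η : η_j = 1 for all ⌊3k/2⌋ ≤ j ≤ 2k}`. -/
def Bk (k : ℕ) : Set Conf :=
  {η | ∀ j, 3 * k / 2 ≤ j → j ≤ 2 * k → η j = true}

/-- `B = ⋂_K ⋃_{k ≥ K} B_k`. -/
def Bbad : Set Conf :=
  ⋂ K : ℕ, ⋃ k : ℕ, ⋃ _ : K ≤ k, Bk k

/-- `b ζ`: the configuration with symbol `b` at site `0` and agreeing with `ζ` on sites `≥ 1`. -/
def consb (b : Bool) (ζ : Conf) : Conf := fun i => if i = 0 then b else ζ i

/-- `1ζ`. -/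
def one (ζ : Conf) : Conf := consb true ζ

/-- The glued configuration equal to `ω` on `[0,n]` and to `η` on `[n+1,∞)`. -/
def glue (ω η : Conf) (n : ℕ) : Conf := fun i => if i ≤ n then ω i else η i

/-- `γ_0(b | ζ_{[1,∞)})`, the single-site conditional probability computed from the
Hamiltonian (the value of `ζ` at site `0` is ignored). -/
noncomputable def gamma0 (ρ : ℝ) (b : Bool) (ζ : Conf) : ℝ :=
  if b then
    Real.exp (-(H ρ (one ζ)).toReal) / (1 + Real.exp (-(H ρ (one ζ)).toReal))
  else 1 / (1 + Real.exp (-(H ρ (one ζ)).toReal))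

/-- The cylinder `[ω_{[1,n]}] = {ζ : ζ_i = ω_i for 1 ≤ i ≤ n}`. -/
def cylTail (ω : Conf) (n : ℕ) : Set Conf :=
  {ζ | ∀ i, 1 ≤ i → i ≤ n → ζ i = ω i}

/-- `A^ω_{ε,n}`: the set of exterior configurations `η` for which the glued configuration
`ω_{[1,n]} η_{[n+1,∞)}` moves the single-site conditional probabilities by more than `ε`. -/
noncomputable def Abad (ρ : ℝ) (ω : Conf) (ε : ℝ) (n : ℕ) : Set Conf :=
  {η | ∃ b : Bool, ε < |gamma0 ρ b (glue ω η n) - gamma0 ρ b ω|}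

/-- The density `exp(-H(ζ))` (equal to `0` when `H(ζ) = ∞`). -/
noncomputable def expH (ρ : ℝ) (ζ : Conf) : ℝ≥0∞ :=
  if H ρ ζ = ⊤ then 0 else ENNReal.ofReal (Real.exp (-(H ρ ζ).toReal))


theorem runLen_congr {w w' : Conf} {m : ℕ} (h : ∀ i ≤ m, w i = w' i) :
    runLen w m = runLen w' m := by
  unfold runLen
  congr 1
  funext j
  simp [h _ (Nat.sub_le m _)]

theorem U_congr (ρ : ℝ) {w w' : Conf} {p : ℕ} (h : ∀ i ≤ 2 * p, w i = w' i) :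
    U ρ w p = U ρ w' p := by
  unfold U
  rw [runLen_congr h, h 0 (Nat.zero_le _), h (2 * p) le_rfl]

/-- A `0` at site `j` bounds the length of the runs ending to the right of `j`. -/
theorem runLen_le_sub {w : Conf} {m j : ℕ} (hj : j ≤ m) (h : w j = false) :
    runLen w m ≤ m - j := by
  by_contra! hlt
  have hspec := Nat.findGreatest_of_ne_zero
    (P := fun j => 0 < j ∧ ∀ i < j, w (m - i) = true) (n := m + 1) (m := runLen w m) rfl
    (Nat.ne_zero_of_lt hlt)
  have := hspec.2 _ hlt
  rw [Nat.sub_sub_self hj, h] at this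
  exact Bool.noConfusion this

theorem ofReal_U_le {ρ : ℝ} (hρ : ρ ∈ Set.Ioo (0 : ℝ) 1) {w : Conf} {p j : ℕ}
    (hj : j ≤ 2 * p) (hpj : p + p / 8 ≤ j) (h : w j = false) :
    ENNReal.ofReal (U ρ w p) ≤ ENNReal.ofReal ρ ^ (p / 8) := by
  rw [← ENNReal.ofReal_pow hρ.1.le]
  apply ENNReal.ofReal_le_ofReal
  have hrun := runLen_le_sub hj h
  unfold U
  split_ifs
  · exact pow_le_pow_of_le_one hρ.1.le hρ.2.le (by omega)
  · exact pow_nonneg hρ.1.le _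

theorem tsum_pow_div_ne_top {c : ℝ≥0∞} (hc : c < 1) (d : ℕ) [NeZero d] :
    ∑' p : ℕ, c ^ (p / d) ≠ ∞ := by
  have h : ∑' p : ℕ, c ^ (p / d) = ∑' x : ℕ × Fin d, c ^ x.1 :=
    (Nat.divModEquiv d).tsum_eq (fun x : ℕ × Fin d => c ^ x.1)
  rw [h, ENNReal.tsum_prod']
  simp only [tsum_fintype, Finset.sum_const, Finset.card_univ, Fintype.card_fin, nsmul_eq_mul]
  rw [ENNReal.tsum_mul_left, ENNReal.tsum_geometric]
  exact ENNReal.mul_ne_top (ENNReal.natCast_ne_top d)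
    (ENNReal.inv_ne_top.2 (tsub_pos_of_lt hc).ne')

theorem tendsto_tsum_pow_div {c : ℝ≥0∞} (hc : c < 1) (d : ℕ) [NeZero d] :
    Tendsto (fun n : ℕ => ∑' k : ℕ, c ^ ((k + (n + 1)) / d)) atTop (𝓝 0) :=
  (ENNReal.tendsto_sum_nat_add (fun p => c ^ (p / d)) (tsum_pow_div_ne_top hc d)).comp
    (tendsto_add_atTop_nat 1)

theorem eventually_exists_false {ω : Conf} (hω : ω ∉ Bbad) :
    ∀ᶠ k : ℕ in atTop, ∃ j, 3 * k / 2 ≤ j ∧ j ≤ 2 * k ∧ ω j = false := by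
  simp only [Bbad, Set.mem_iInter, Set.mem_iUnion, Bk, Set.mem_ofPred_eq, not_forall, not_exists,
    exists_prop] at hω
  obtain ⟨K, hK⟩ := hω
  filter_upwards [eventually_ge_atTop K] with k hk
  by_contra! h
  exact hK k ⟨hk, fun j hj hj' => by simpa using h j hj hj'⟩

theorem measure_cylTail {ν : Measure Conf} (hν : IsBernoulliHalf ν) (ω : Conf) (n : ℕ) :
    ν (cylTail ω n) = (2 : ℝ≥0∞)⁻¹ ^ n := by
  have h := hν.2 (Finset.Icc 1 n) ω
  simpa [cylTail] using h

theorem measure_cylTail_inter_run {ν : Measure Conf} (hν : IsBernoulliHalf ν) (ω : Conf)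
    {n m l : ℕ} (h : n + l ≤ m) :
    ν (cylTail ω n ∩ {η | ∀ j, m - l < j → j ≤ m → η j = true}) =
      (2 : ℝ≥0∞)⁻¹ ^ n * (2 : ℝ≥0∞)⁻¹ ^ l := by
  have hd : Disjoint (Finset.Icc 1 n) (Finset.Ioc (m - l) m) := by
    rw [Finset.disjoint_left]
    intro i hi hi'
    rw [Finset.mem_Icc] at hi
    rw [Finset.mem_Ioc] at hi'
    omega
  have hset : cylTail ω n ∩ {η | ∀ j, m - l < j → j ≤ m → η j = true} =
      {η | ∀ i ∈ Finset.Icc 1 n ∪ Finset.Ioc (m - l) m,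
        η i = if i ≤ n then ω i else true} := by
    ext η
    simp only [cylTail, Set.mem_inter_iff, Set.mem_ofPred_eq, Finset.mem_union, Finset.mem_Icc,
      Finset.mem_Ioc]
    constructor
    · rintro ⟨h₁, h₂⟩ i (hi | hi)
      · rw [if_pos hi.2, h₁ i hi.1 hi.2]
      · rw [if_neg (by omega), h₂ i hi.1 hi.2]
    · intro hη
      refine ⟨fun i hi hi' => ?_, fun i hi hi' => ?_⟩
      · rw [hη i (Or.inl ⟨hi, hi'⟩), if_pos hi']
      · rw [hη i (Or.inr ⟨hi, hi'⟩), if_neg (by omega)]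
  rw [hset, hν.2, Finset.card_union_of_disjoint hd, Nat.card_Icc, Nat.card_Ioc, ← pow_add]
  congr 1
  omega

/-- Configurations with a long run of `1`s, entirely to the right of site `2n`, that ends at some
site `2p` with `p > n`. -/
def longRun (n : ℕ) : Set Conf :=
  ⋃ k : ℕ, {η | 2 * n + (k + (n + 1)) / 4 ≤ 2 * (k + (n + 1)) ∧
    ∀ j, 2 * (k + (n + 1)) - (k + (n + 1)) / 4 < j → j ≤ 2 * (k + (n + 1)) → η j = true}

theorem measure_cylTail_inter_longRun_le {ν : Measure Conf} (hν : IsBernoulliHalf ν) (ω : Conf)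
    (n : ℕ) :
    ν (cylTail ω (2 * n) ∩ longRun n) ≤
      (2 : ℝ≥0∞)⁻¹ ^ (2 * n) * ∑' k : ℕ, (2 : ℝ≥0∞)⁻¹ ^ ((k + (n + 1)) / 4) := by
  rw [longRun, Set.inter_iUnion, ← ENNReal.tsum_mul_left]
  refine (measure_iUnion_le _).trans (ENNReal.tsum_le_tsum fun k => ?_)
  by_cases h : 2 * n + (k + (n + 1)) / 4 ≤ 2 * (k + (n + 1))
  · rw [← measure_cylTail_inter_run hν ω h]
    exact measure_mono (Set.inter_subset_inter_right _ fun η hη => hη.2)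
  · simp [h]

theorem H_eq_sum_add (ρ : ℝ) (w : Conf) (n : ℕ) :
    H ρ w = ∑ p ∈ Finset.range n, ENNReal.ofReal (U ρ w (p + 1)) +
      ∑' k : ℕ, ENNReal.ofReal (U ρ w (k + (n + 1))) := by
  rw [H, ← Summable.sum_add_tsum_nat_add' (k := n) ENNReal.summable]
  simp only [add_assoc]

/-- If all terms past `n` of both Hamiltonians are controlled by `a` and the terms up to `n`
coincide, the Hamiltonians differ at most by the tail sum of `a`. -/
theorem abs_toReal_H_sub_le {ρ : ℝ} {w w' : Conf} {n : ℕ} {a : ℕ → ℝ≥0∞}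
    (ha : ∑' k, a k ≠ ∞) (hww : ∀ i ≤ 2 * n, w i = w' i)
    (hw : ∀ k, ENNReal.ofReal (U ρ w (k + (n + 1))) ≤ a k)
    (hw' : ∀ k, ENNReal.ofReal (U ρ w' (k + (n + 1))) ≤ a k) :
    |(H ρ w).toReal - (H ρ w').toReal| ≤ (∑' k, a k).toReal := by
  have hT := ENNReal.tsum_le_tsum hw
  have hT' := ENNReal.tsum_le_tsum hw'
  have hsum : ∑ p ∈ Finset.range n, ENNReal.ofReal (U ρ w (p + 1)) =
      ∑ p ∈ Finset.range n, ENNReal.ofReal (U ρ w' (p + 1)) := by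
    refine Finset.sum_congr rfl fun p hp => ?_
    rw [Finset.mem_range] at hp
    rw [U_congr ρ fun i hi => hww i (by omega)]
  have hfin : ∑ p ∈ Finset.range n, ENNReal.ofReal (U ρ w' (p + 1)) ≠ ∞ :=
    ENNReal.sum_ne_top.2 fun _ _ => ENNReal.ofReal_ne_top
  rw [H_eq_sum_add ρ w n, H_eq_sum_add ρ w' n, hsum,
    ENNReal.toReal_add hfin (ne_top_of_le_ne_top ha hT),
    ENNReal.toReal_add hfin (ne_top_of_le_ne_top ha hT'), add_sub_add_left_eq_sub]
  exact abs_sub_le_of_nonneg_of_le ENNReal.toReal_nonneg (ENNReal.toReal_mono ha hT)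
    ENNReal.toReal_nonneg (ENNReal.toReal_mono ha hT')

theorem exists_pos_abs_gamma0_sub_lt (ρ : ℝ) (ω : Conf) {ε : ℝ} (hε : 0 < ε) :
    ∃ δ > 0, ∀ ζ : Conf, |(H ρ (one ζ)).toReal - (H ρ (one ω)).toReal| < δ →
      ∀ b, |gamma0 ρ b ζ - gamma0 ρ b ω| < ε := by
  have hpos : ∀ x : ℝ, 1 + Real.exp (-x) ≠ 0 := fun x => by positivity
  have h₁ : Continuous fun x : ℝ => Real.exp (-x) / (1 + Real.exp (-x)) :=
    Continuous.div (by fun_prop) (by fun_prop) hpos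
  have h₀ : Continuous fun x : ℝ => 1 / (1 + Real.exp (-x)) :=
    Continuous.div (by fun_prop) (by fun_prop) hpos
  obtain ⟨δ₁, hδ₁, H₁⟩ := Metric.continuous_iff.1 h₁ (H ρ (one ω)).toReal ε hε
  obtain ⟨δ₀, hδ₀, H₀⟩ := Metric.continuous_iff.1 h₀ (H ρ (one ω)).toReal ε hε
  refine ⟨min δ₁ δ₀, lt_min hδ₁ hδ₀, fun ζ hζ b => ?_⟩
  cases b
  · simpa [gamma0, Real.dist_eq] using H₀ _ (hζ.trans_le (min_le_right _ _))
  · simpa [gamma0, Real.dist_eq] using H₁ _ (hζ.trans_le (min_le_left _ _))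

theorem one_glue_of_le (ω η : Conf) {n i : ℕ} (hi : i ≤ n) :
    one (glue ω η n) i = one ω i := by
  simp [one, consb, glue, hi]

theorem one_glue_of_lt (ω η : Conf) {n i : ℕ} (hi : n < i) :
    one (glue ω η n) i = η i := by
  simp [one, consb, glue, hi.not_ge, Nat.ne_zero_of_lt hi]

theorem one_of_pos (ω : Conf) {i : ℕ} (hi : 0 < i) : one ω i = ω i := by
  simp [one, consb, hi.ne']

theorem ofReal_U_one_glue_le {ρ : ℝ} (hρ : ρ ∈ Set.Ioo (0 : ℝ) 1) {ω η : Conf} {n : ℕ}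
    (hn : 10 ≤ n) (hω : ∃ j, 3 * n / 2 ≤ j ∧ j ≤ 2 * n ∧ ω j = false) (hη : η ∉ longRun n)
    (k : ℕ) :
    ENNReal.ofReal (U ρ (one (glue ω η (2 * n))) (k + (n + 1))) ≤
      ENNReal.ofReal ρ ^ ((k + (n + 1)) / 8) := by
  by_cases hk : k + (n + 1) + (k + (n + 1)) / 8 ≤ 3 * n / 2
  · obtain ⟨j, hj₁, hj₂, hj⟩ := hω
    exact ofReal_U_le hρ (j := j) (by omega) (by omega)
      (by rw [one_glue_of_le ω η hj₂, one_of_pos ω (by omega), hj])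
  · have hη' : ∃ j, 2 * (k + (n + 1)) - (k + (n + 1)) / 4 < j ∧ j ≤ 2 * (k + (n + 1)) ∧
        η j = false := by
      by_contra! h
      exact hη (Set.mem_iUnion.2 ⟨k, by omega, fun j hj hj' => by simpa using h j hj hj'⟩)
    obtain ⟨j, hj₁, hj₂, hj⟩ := hη'
    exact ofReal_U_le hρ hj₂ (by omega) (by rw [one_glue_of_lt ω η (by omega), hj])

theorem eventually_Abad_subset_longRun {ρ : ℝ} (hρ : ρ ∈ Set.Ioo (0 : ℝ) 1) {ω : Conf}
    (hω : ω ∉ Bbad) {ε : ℝ} (hε : 0 < ε) :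
    ∀ᶠ n : ℕ in atTop, Abad ρ ω ε (2 * n) ⊆ longRun n := by
  have hρ' : ENNReal.ofReal ρ < 1 := ENNReal.ofReal_lt_one.2 hρ.2
  have htail := tendsto_tsum_pow_div hρ' 8
  obtain ⟨δ, hδ, hγ⟩ := exists_pos_abs_gamma0_sub_lt ρ ω hε
  filter_upwards [eventually_forall_ge_atTop.2 (eventually_exists_false hω), eventually_ge_atTop 10,
    htail.eventually_lt_const (ENNReal.ofReal_pos.2 hδ)] with n hzero hn hlt
  intro η hA
  by_contra hη
  obtain ⟨b, hb⟩ := hA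
  refine hb.not_gt (hγ _ ((abs_toReal_H_sub_le hlt.ne_top
    (fun i hi => one_glue_of_le ω η hi) (ofReal_U_one_glue_le hρ hn (hzero n le_rfl) hη)
    fun k => ?_).trans_lt ((ENNReal.lt_ofReal_iff_toReal_lt hlt.ne_top).1 hlt)) b)
  obtain ⟨j, hj₁, hj₂, hj⟩ := hzero (k + (n + 1)) (by omega)
  exact ofReal_U_le hρ hj₂ (by omega) (by rw [one_of_pos ω (by omega), hj])

/-- For every `ω ∉ B` and `ε > 0`,
`ν([ω_{[1,2n]}] ∩ A^ω_{ε,2n}) / ν([ω_{[1,2n]}]) → 0`; here `ν([ω_{[1,2n]}]) = 2^{-2n}`. -/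
theorem nu_ratio_tendsto_zero
    (ρ : ℝ) (hρ : ρ ∈ Set.Ioo (0 : ℝ) 1)
    (ν : Measure Conf) (hν : IsBernoulliHalf ν)
    (ω : Conf) (hω : ω ∉ Bbad) (ε : ℝ) (hε : 0 < ε) :
    (∀ n : ℕ, ν (cylTail ω (2 * n)) = (2 : ℝ≥0∞)⁻¹ ^ (2 * n)) ∧
    Tendsto
      (fun n : ℕ => ν (cylTail ω (2 * n) ∩ Abad ρ ω ε (2 * n)) / ν (cylTail ω (2 * n)))
      atTop (nhds 0) := by
  refine ⟨fun n => measure_cylTail hν ω (2 * n), ?_⟩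
  refine tendsto_of_tendsto_of_tendsto_of_le_of_le' tendsto_const_nhds
    (tendsto_tsum_pow_div ENNReal.one_half_lt_one 4) (Eventually.of_forall fun _ => zero_le) ?_
  filter_upwards [eventually_Abad_subset_longRun hρ hω hε] with n hn
  rw [measure_cylTail hν]
  refine ENNReal.div_le_of_le_mul' ?_
  exact (measure_mono (Set.inter_subset_inter_right _ hn)).trans
    (measure_cylTail_inter_longRun_le hν ω n)

end WeakGibbsExample
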